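/- Let D' be a minimal partial clique with minimum out-degree δ⁺(D') = 2 and |V(D')| ≥ 3. Then D' contains a figure-of-eight: two directed cycles C_1 and C_2 intersecting in exactly one common vertex. -/

import Mathlib

open Finset
open scoped Classical

universe u

variable {V : Type u}

/-- `l` is a directed cycle: nonempty, distinct vertices, consecutive arcs, wrap-around arc. -/
def IsCycle (A : V → V → Prop) (l : List V) : Prop :=
  l ≠ [] ∧ l.Nodup ∧ l.Chain' A ∧
    ∀ a b, l.getLast? = some a → l.head? = some b → A a b

/-- `l` is a directed path from `i` to `j`. -/
def IsPath (A : V → V → Prop) (l : List V) (i j : V) : Prop :=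
  l.Nodup ∧ l.Chain' A ∧ l.head? = some i ∧ l.getLast? = some j

/-- An I-path w.r.t. inner vertex set `VI`: a path between two distinct inner vertices
whose interior vertices are all non-inner. -/
def IsIPath [DecidableEq V] (A : V → V → Prop) (VI : Finset V) (l : List V) (i j : V) : Prop :=
  IsPath A l i j ∧ i ∈ VI ∧ j ∈ VI ∧ i ≠ j ∧ ∀ v ∈ l.dropLast.drop 1, v ∉ VI

/-- An I-cycle: a directed cycle containing exactly one inner vertex. -/
def IsICycle [DecidableEq V] (A : V → V → Prop) (VI : Finset V) (l : List V) : Prop :=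
  IsCycle A l ∧ (l.toFinset ∩ VI).card = 1

/-- A K-IC structure: exactly one I-path between each ordered pair of distinct inner
vertices, and no I-cycle. -/
def IsKIC [DecidableEq V] (A : V → V → Prop) (VI : Finset V) : Prop :=
  (∀ i ∈ VI, ∀ j ∈ VI, i ≠ j → ∃! l : List V, IsIPath A VI l i j) ∧
  ∀ l : List V, ¬ IsICycle A VI l

/-- Out-degree of a vertex. -/
noncomputable def outDeg [Fintype V] (A : V → V → Prop) (v : V) : ℕ :=
  (univ.filter fun w => A v w).card

/-- Minimum out-degree of a digraph. -/
noncomputable def minOutDeg [Fintype V] [Nonempty V] (A : V → V → Prop) : ℕ :=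
  univ.inf' univ_nonempty (outDeg A)

/-- Out-degree of `v` within the subdigraph induced on `s`. -/
noncomputable def outDegOn (A : V → V → Prop) (s : Finset V) (v : V) : ℕ :=
  (s.filter fun w => A v w).card

/-- Minimum out-degree of the subdigraph induced on `s` (0 if `s` is empty). -/
noncomputable def minOutDegOn (A : V → V → Prop) (s : Finset V) : ℕ :=
  if h : s.Nonempty then s.inf' h (outDegOn A s) else 0

/-- Induced arc relation on a vertex subset. -/
def inducedRel (A : V → V → Prop) (s : Finset V) : V → V → Prop :=
  fun u v => u ∈ s ∧ v ∈ s ∧ A u v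

/-- A valid index code of length `p` for `t`-bit messages: the messages of every receiver
are determined by the codeword together with its side information (its out-neighbours'
messages). -/
def IsIndexCode [Fintype V] (A : V → V → Prop) (t p : ℕ)
    (F : (V → (Fin t → ZMod 2)) → (Fin p → ZMod 2)) : Prop :=
  ∀ x y : V → (Fin t → ZMod 2), F x = F y →
    ∀ i : V, (∀ q, A i q → x q = y q) → x i = y i

/-- No directed cycle lies entirely inside `s`. -/
def AcyclicOn (A : V → V → Prop) (s : Finset V) : Prop :=
  ∀ l : List V, IsCycle A l → ¬ (∀ v ∈ l, v ∈ s)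

/-- `s` (as a partial clique) is minimal: its savings `δ⁺` strictly exceed the total
savings of any partition of `s` into at least two parts. -/
def IsMinimalPC [DecidableEq V] (A : V → V → Prop) (s : Finset V) : Prop :=
  ∀ P : Finpartition s, 2 ≤ P.parts.card →
    ∑ p ∈ P.parts, minOutDegOn A p < minOutDegOn A s

/-- A directed rooted tree inside the digraph `A`, rooted at inner vertex `i`, whose
leaves are exactly the other inner vertices and whose internal vertices are non-inner. -/
structure IsICTree [DecidableEq V] (A : V → V → Prop) (VI : Finset V) (i : V)
    (T : V → V → Prop) : Prop where
  sub : ∀ u v, T u v → A u v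
  root_mem : i ∈ VI
  root_no_parent : ∀ u, ¬ T u i
  unique_parent : ∀ u u' v, T u v → T u' v → u = u'
  reach : ∀ j ∈ VI, j ≠ i → Relation.ReflTransGen T i j
  leaf : ∀ j ∈ VI, j ≠ i → ∀ w, ¬ T j w
  connected : ∀ u v, T u v → Relation.ReflTransGen T i u
  acyclic : ∀ v, ¬ Relation.TransGen T v v

/-- The Class-A digraph on `3*m` vertices (`K = 2*m` inner vertices `0,…,K-1`,
outer vertices `K,…,3m-1`): outer vertex `K+i` has arcs to inner `2i` and `2i+1`;
inner `2i` and `2i+1` have mutual arcs and arcs to every outer vertex except `K+i`. -/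
def classARel (m : ℕ) : Fin (3 * m) → Fin (3 * m) → Prop := fun u v =>
  (2 * m ≤ u.val ∧ v.val < 2 * m ∧ v.val / 2 = u.val - 2 * m) ∨
  (u.val < 2 * m ∧ v.val < 2 * m ∧ u.val / 2 = v.val / 2 ∧ u ≠ v) ∨
  (u.val < 2 * m ∧ 2 * m ≤ v.val ∧ v.val - 2 * m ≠ u.val / 2)

theorem isCycle_cons_iff {A : V → V → Prop} {a : V} {t : List V} :
    IsCycle A (a :: t) ↔ (a :: t).Nodup ∧ (a :: (t ++ [a])).IsChain A := by
  have h : (a :: (t ++ [a])) = (a :: t) ++ [a] := rfl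
  rw [h, List.isChain_append]
  simp only [IsCycle, ne_eq, reduceCtorEq, not_false_eq_true, true_and, List.head?_cons,
    List.isChain_singleton, Option.mem_def, Option.some.injEq]
  constructor
  · rintro ⟨hn, hc, hw⟩
    exact ⟨hn, hc, fun x hx y hy => hw x y hx hy⟩
  · rintro ⟨hn, hc, hw⟩
    exact ⟨hn, hc, fun x y hx hy => hw x hx y hy⟩

theorem IsCycle.rotate_to {A : V → V → Prop} {s : V} {l₁ l₂ : List V}
    (h : IsCycle A (l₁ ++ s :: l₂)) : IsCycle A (s :: (l₂ ++ l₁)) := by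
  cases l₁ with
  | nil => simpa using h
  | cons b t =>
    rw [List.cons_append, isCycle_cons_iff] at h
    obtain ⟨hn, hc⟩ := h
    rw [isCycle_cons_iff]
    refine ⟨?_, ?_⟩
    · have hp : (b :: (t ++ s :: l₂)).Perm (s :: (l₂ ++ b :: t)) :=
        (List.perm_append_comm (l₁ := b :: t) (l₂ := s :: l₂))
      exact hp.nodup_iff.mp hn
    · have e₁ : b :: (t ++ s :: l₂ ++ [b]) = (b :: t) ++ s :: (l₂ ++ [b]) := by simp
      have e₂ : s :: (l₂ ++ b :: t ++ [s]) = (s :: l₂) ++ b :: (t ++ [s]) := by simp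
      rw [e₁, List.isChain_split] at hc
      rw [e₂, List.isChain_split]
      exact ⟨by simpa using hc.2, by simpa using hc.1⟩

/-- A nonempty finite set in which every vertex has an in-neighbour contains a cycle. -/
theorem exists_isCycle_of_forall_exists_inNeighbor {A : V → V → Prop} {T : Finset V}
    (hT : T.Nonempty) (h : ∀ x ∈ T, ∃ w ∈ T, A w x) :
    ∃ l : List V, IsCycle A l ∧ ∀ v ∈ l, v ∈ T := by
  by_contra hno
  have key : ∀ n : ℕ, ∃ a l, (a :: l).length = n + 1 ∧ (a :: l).Nodup ∧ (a :: l).IsChain A ∧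
      ∀ v ∈ a :: l, v ∈ T := by
    intro n
    induction n with
    | zero =>
      obtain ⟨a, ha⟩ := hT
      exact ⟨a, [], by simpa using ha⟩
    | succ n ih =>
      obtain ⟨a, l, hlen, hn, hc, hl⟩ := ih
      obtain ⟨w, hw, hwa⟩ := h a (hl a (by simp))
      refine ⟨w, a :: l, by simpa using hlen, ?_, ?_, ?_⟩
      · refine List.nodup_cons.mpr ⟨fun hmem => hno ?_, hn⟩
        obtain ⟨p, q, hpq⟩ := List.append_of_mem hmem
        have hn' : (w :: p).Nodup := by
          rw [hpq] at hn
          have := (List.perm_middle (a := w) (l₁ := p) (l₂ := q)).nodup_iff.mp hn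
          exact this.sublist (by simp)
        refine ⟨w :: p, isCycle_cons_iff.mpr ⟨hn', ?_⟩, ?_⟩
        · cases p with
          | nil =>
            simp only [List.nil_append, List.cons.injEq] at hpq
            simpa [← hpq.1] using hwa
          | cons b p =>
            rw [hpq, List.isChain_split] at hc
            simp only [List.cons_append, List.cons.injEq] at hpq
            rw [← hpq.1] at hc ⊢
            exact List.isChain_cons_cons.mpr ⟨hwa, hc.1⟩
        · intro v hv
          apply hl
          rw [hpq]
          simp only [List.mem_cons, List.mem_append] at hv ⊢
          tauto
      · exact List.isChain_cons_cons.mpr ⟨hwa, hc⟩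
      · intro v hv
        rcases List.mem_cons.mp hv with rfl | hv
        · exact hw
        · exact hl v hv
  obtain ⟨a, l, hlen, hn, -, hl⟩ := key T.card
  have hle : (a :: l).toFinset.card ≤ T.card :=
    card_le_card fun v hv => hl v (List.mem_toFinset.mp hv)
  rw [List.toFinset_card_of_nodup hn, hlen] at hle
  omega

theorem exists_nodup_isChain_of_reflTransGen {r : V → V → Prop} {a b : V}
    (h : Relation.ReflTransGen r a b) :
    ∃ l : List V, (a :: l).Nodup ∧ (a :: l).IsChain r ∧ (a :: l).getLast? = some b := by
  induction h using Relation.ReflTransGen.head_induction_on with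
  | refl => exact ⟨[], by simp⟩
  | @head a c hac _ ih =>
    obtain ⟨l, hn, hc, hb⟩ := ih
    by_cases ha : a ∈ c :: l
    · obtain ⟨p, q, hpq⟩ := List.append_of_mem ha
      rw [hpq] at hn hc hb
      exact ⟨q, hn.sublist (by simp), (List.isChain_split.mp hc).2, by simpa using hb⟩
    · exact ⟨c :: l, List.nodup_cons.mpr ⟨ha, hn⟩, List.isChain_cons_cons.mpr ⟨hac, hc⟩,
        by simpa using hb⟩

/-- Two directed cycles inside `S` whose only common vertex is `u`. The two cycles may coincide
when they are a loop at `u`. -/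
def FigureEightOn (A : V → V → Prop) (S : Finset V) (u : V) : Prop :=
  ∃ l₁ l₂ : List V, IsCycle A l₁ ∧ IsCycle A l₂ ∧ (∀ v ∈ l₁, v ∈ S) ∧ (∀ v ∈ l₂, v ∈ S) ∧
    ∀ v, v ∈ l₁ ∧ v ∈ l₂ ↔ v = u

theorem FigureEightOn.mono {A : V → V → Prop} {S S' : Finset V} {u : V} (hS : S ⊆ S')
    (h : FigureEightOn A S u) : FigureEightOn A S' u := by
  obtain ⟨l₁, l₂, h₁, h₂, m₁, m₂, hu⟩ := h
  exact ⟨l₁, l₂, h₁, h₂, fun v hv => hS (m₁ v hv), fun v hv => hS (m₂ v hv), hu⟩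

theorem figureEightOn_of_loop {A : V → V → Prop} {S : Finset V} {u : V} (hu : u ∈ S)
    (h : A u u) : FigureEightOn A S u := by
  have hc : IsCycle A [u] := isCycle_cons_iff.mpr (by simpa using h)
  exact ⟨[u], [u], hc, hc, by simpa using hu, by simpa using hu, by simp⟩

/-- Contraction of the arc `e → m` onto `m`: arcs into `e` are redirected to `m`, and the arcs
leaving `e` are forgotten (once restricted to the vertices other than `e`). -/
def contractRel (A : V → V → Prop) (e m : V) : V → V → Prop :=
  fun p q => A p q ∨ (q = m ∧ A p e)

theorem isChain_of_isChain_contractRel {A : V → V → Prop} {e m : V} {t : List V} (hm : m ∉ t)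
    {c : V} (h : (c :: t).IsChain (contractRel A e m)) : (c :: t).IsChain A := by
  induction t generalizing c with
  | nil => simp
  | cons d t ih =>
    rw [List.isChain_cons_cons] at h ⊢
    rw [List.mem_cons, not_or] at hm
    exact ⟨h.1.resolve_right fun hd => hm.1 hd.1.symm, ih hm.2 h.2⟩

/-- A cycle of the contraction is a cycle of the original digraph, possibly after inserting `e`
before `m`. -/
theorem IsCycle.lift_contractRel {A : V → V → Prop} {e m : V} (hem : A e m) {l : List V}
    (hl : IsCycle (contractRel A e m) l) (he : e ∉ l) :
    ∃ l', IsCycle A l' ∧ (∀ v ∈ l, v ∈ l') ∧ ∀ v ∈ l', v ∈ l ∨ (v = e ∧ m ∈ l) := by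
  by_cases hm : m ∈ l
  · obtain ⟨p, q, rfl⟩ := List.append_of_mem hm
    have hr := hl.rotate_to
    have hmem : ∀ v, v ∈ p ++ m :: q ↔ v ∈ m :: (q ++ p) := by
      intro v
      simp only [List.mem_cons, List.mem_append]
      tauto
    simp only [hmem] at he ⊢
    generalize q ++ p = t at hr he
    obtain ⟨-, hn, hc, hw⟩ := hr
    have hcA := isChain_of_isChain_contractRel (List.nodup_cons.mp hn).1 hc
    obtain ⟨z, hz⟩ : ∃ z, (m :: t).getLast? = some z :=
      ⟨_, List.getLast?_eq_getLast_of_ne_nil (by simp)⟩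
    rcases hw z m hz rfl with hzm | ⟨-, hze⟩
    · refine ⟨m :: t, ⟨by simp, hn, hcA, ?_⟩, fun v hv => hv, fun v hv => Or.inl hv⟩
      intro a b ha hb
      rw [hz, Option.some.injEq] at ha
      rw [List.head?_cons, Option.some.injEq] at hb
      rwa [← ha, ← hb]
    · refine ⟨e :: m :: t, ⟨by simp, List.nodup_cons.mpr ⟨he, hn⟩,
        List.isChain_cons_cons.mpr ⟨hem, hcA⟩, ?_⟩, fun v hv => List.mem_cons_of_mem _ hv, ?_⟩
      · intro a b ha hb
        rw [List.getLast?_cons_cons, hz, Option.some.injEq] at ha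
        rw [List.head?_cons, Option.some.injEq] at hb
        rwa [← ha, ← hb]
      · intro v hv
        rcases List.mem_cons.mp hv with rfl | hv
        · exact Or.inr ⟨rfl, by simp⟩
        · exact Or.inl hv
  · refine ⟨l, ?_, fun v hv => hv, fun v hv => Or.inl hv⟩
    obtain ⟨hne, hn, hc, hw⟩ := hl
    cases l with
    | nil => exact absurd rfl hne
    | cons a t =>
      rw [List.mem_cons, not_or] at hm
      refine ⟨hne, hn, isChain_of_isChain_contractRel hm.2 hc, fun x y hx hy => ?_⟩
      rw [List.head?_cons, Option.some.injEq] at hy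
      exact (hw x y hx (by simp [hy])).resolve_right fun h => hm.1 (hy.trans h.1).symm

theorem FigureEightOn.of_contractRel {A : V → V → Prop} {S : Finset V} {e m u : V}
    (hem : A e m) (heS : e ∈ S) (hum : u ≠ m)
    (h : FigureEightOn (contractRel A e m) (S.erase e) u) : FigureEightOn A S u := by
  obtain ⟨l₁, l₂, h₁, h₂, m₁, m₂, hu⟩ := h
  have he : ∀ l : List V, (∀ v ∈ l, v ∈ S.erase e) → e ∉ l := fun l hl hel => by
    simpa using hl e hel
  obtain ⟨k₁, c₁, s₁, t₁⟩ := h₁.lift_contractRel hem (he _ m₁)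
  obtain ⟨k₂, c₂, s₂, t₂⟩ := h₂.lift_contractRel hem (he _ m₂)
  refine ⟨k₁, k₂, c₁, c₂, ?_, ?_, ?_⟩
  · intro v hv
    rcases t₁ v hv with hv | ⟨rfl, -⟩
    · exact mem_of_mem_erase (m₁ v hv)
    · exact heS
  · intro v hv
    rcases t₂ v hv with hv | ⟨rfl, -⟩
    · exact mem_of_mem_erase (m₂ v hv)
    · exact heS
  · intro v
    constructor
    · rintro ⟨hv₁, hv₂⟩
      rcases t₁ v hv₁ with hv₁ | ⟨rfl, hm₁⟩
      · rcases t₂ v hv₂ with hv₂ | ⟨rfl, hm₂⟩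
        · exact (hu v).mp ⟨hv₁, hv₂⟩
        · exact absurd hv₁ (he _ m₁)
      · rcases t₂ v hv₂ with hv₂ | ⟨-, hm₂⟩
        · exact absurd hv₂ (he _ m₂)
        · exact absurd ((hu m).mp ⟨hm₁, hm₂⟩).symm hum
    · rintro rfl
      obtain ⟨a, b⟩ := (hu v).mpr rfl
      exact ⟨s₁ v a, s₂ v b⟩

/-- A cycle `c` all of whose vertices have an arc to a vertex `s` outside it forms a figure of
eight with a path from `s` to it. -/
theorem figureEightOn_of_reach_cycle {A : V → V → Prop} {S : Finset V} {s z : V} {c : List V}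
    (hs : s ∈ S) (hc : IsCycle A c) (hcS : ∀ v ∈ c, v ∈ S) (hcs : ∀ v ∈ c, A v s) (hz : z ∈ c)
    (hr : Relation.ReflTransGen (fun p q => A p q ∧ p ∉ c ∧ q ∈ S) s z) :
    FigureEightOn A S z := by
  obtain ⟨l, hn, hl, hlast⟩ := exists_nodup_isChain_of_reflTransGen hr
  have hlS : ∀ v ∈ l, v ∈ S := by
    have : ∀ (t : List V) (a : V), (a :: t).IsChain (fun p q => A p q ∧ p ∉ c ∧ q ∈ S) →
        ∀ v ∈ t, v ∈ S := by
      intro t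
      induction t with
      | nil => simp
      | cons b t ih =>
        intro a h v hv
        rw [List.isChain_cons_cons] at h
        rcases List.mem_cons.mp hv with rfl | hv
        · exact h.1.2.2
        · exact ih b h.2 v hv
    exact this l s hl
  refine ⟨s :: l, c, ?_, hc, ?_, hcS, ?_⟩
  · refine ⟨by simp, hn, hl.imp fun _ _ h => h.1, ?_⟩
    intro a b ha hb
    simp only [List.head?_cons, Option.some.injEq] at hb
    rw [hlast, Option.some.injEq] at ha
    rw [← ha, ← hb]
    exact hcs z hz
  · intro v hv
    rcases List.mem_cons.mp hv with rfl | hv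
    · exact hs
    · exact hlS v hv
  · intro v
    constructor
    · rintro ⟨hv, hvc⟩
      obtain ⟨p, q, hpq⟩ := List.append_of_mem hv
      rw [hpq] at hl hlast
      cases q with
      | nil => simpa using hlast
      | cons b q =>
        have := (List.isChain_split.mp hl).2
        rw [List.isChain_cons_cons] at this
        exact absurd hvc this.1.2.1
    · rintro rfl
      exact ⟨List.mem_of_getLast? hlast, hz⟩

/-- If every vertex of `S` other than `s` has two out-neighbours in `S`, and `s` has an
out-neighbour other than itself, there is a figure of eight centred away from `s`. -/
theorem exists_figureEightOn_ne (n : ℕ) : ∀ (A : V → V → Prop) (S : Finset V) (s : V),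
    S.card = n → s ∈ S →
    (∀ v ∈ S, v ≠ s → ∃ a ∈ S, ∃ b ∈ S, a ≠ b ∧ A v a ∧ A v b) →
    (∃ y ∈ S, y ≠ s ∧ A s y) → ∃ u ∈ S, u ≠ s ∧ FigureEightOn A S u := by
  induction n using Nat.strong_induction_on with
  | _ n ih =>
  intro A S s hcard hs hdeg hsy
  by_contra hno
  push Not at hno
  have hloop : ∀ v ∈ S, v ≠ s → ¬ A v v := fun v hv hvs h =>
    hno v hv hvs (figureEightOn_of_loop hv h)
  have hcontract : ∀ e ∈ S, ∀ m ∈ S, e ≠ m → (e = s ∨ m = s) → A e m →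
      (∃ y ∈ S, y ≠ e ∧ y ≠ m ∧ A m y) → ∃ w ∈ S, w ≠ e ∧ w ≠ m ∧ A w e ∧ A w m := by
    intro e he m hm hne hor hem ⟨y, hy, hye, hym, hmy⟩
    by_contra hw
    push Not at hw
    obtain ⟨u, hu, hum, hfig⟩ := ih (S.erase e).card
      (by rw [← hcard]; exact card_erase_lt_of_mem he)
      (contractRel A e m) (S.erase e) m rfl (mem_erase.mpr ⟨hne.symm, hm⟩) (by
        intro v hv hvm
        obtain ⟨hve, hvS⟩ := mem_erase.mp hv
        have hvs : v ≠ s := by rcases hor with rfl | rfl <;> assumption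
        obtain ⟨a, ha, b, hb, hab, hva, hvb⟩ := hdeg v hvS hvs
        by_cases hae : a = e
        · subst hae
          refine ⟨m, mem_erase.mpr ⟨hne.symm, hm⟩, b, mem_erase.mpr ⟨hab.symm, hb⟩, ?_,
            Or.inr ⟨rfl, hva⟩, Or.inl hvb⟩
          rintro rfl
          exact hw v hvS hve hvm hva hvb
        · by_cases hbe : b = e
          · subst hbe
            refine ⟨m, mem_erase.mpr ⟨hne.symm, hm⟩, a, mem_erase.mpr ⟨hae, ha⟩, ?_,
              Or.inr ⟨rfl, hvb⟩, Or.inl hva⟩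
            rintro rfl
            exact hw v hvS hve hvm hvb hva
          · exact ⟨a, mem_erase.mpr ⟨hae, ha⟩, b, mem_erase.mpr ⟨hbe, hb⟩, hab,
              Or.inl hva, Or.inl hvb⟩)
      ⟨y, mem_erase.mpr ⟨hye, hy⟩, hym, Or.inl hmy⟩
    obtain ⟨hue, huS⟩ := mem_erase.mp hu
    have hus : u ≠ s := by rcases hor with rfl | rfl <;> assumption
    exact hno u huS hus (hfig.of_contractRel hem he hum)
  have hother : ∀ v ∈ S, v ≠ s → ∀ x, ∃ y ∈ S, y ≠ x ∧ y ≠ v ∧ A v y := by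
    intro v hv hvs x
    obtain ⟨a, ha, b, hb, hab, hva, hvb⟩ := hdeg v hv hvs
    have hav : a ≠ v := fun h => hloop v hv hvs (h ▸ hva)
    have hbv : b ≠ v := fun h => hloop v hv hvs (h ▸ hvb)
    by_cases hax : a = x
    · exact ⟨b, hb, hax ▸ hab.symm, hbv, hvb⟩
    · exact ⟨a, ha, hax, hav, hva⟩
  have hin : ∀ x ∈ S, x ≠ s → A x s → ∃ w ∈ S, w ≠ s ∧ A w x ∧ A w s := by
    intro x hx hxs hxsA
    obtain ⟨y, hy, hys, hsyA⟩ := hsy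
    by_cases hyx : y = x
    · subst hyx
      obtain ⟨w, hw, hws, -, h₁, h₂⟩ := hcontract s hs y hy hys.symm (Or.inl rfl) hsyA
        (hother y hy hys s)
      exact ⟨w, hw, hws, h₂, h₁⟩
    · obtain ⟨w, hw, -, hws, h₁, h₂⟩ := hcontract x hx s hs hxs (Or.inr rfl) hxsA
        ⟨y, hy, hyx, hys, hsyA⟩
      exact ⟨w, hw, hws, h₁, h₂⟩
  let T := S.filter fun x => x ≠ s ∧ A x s
  have hT : T.Nonempty := by
    by_contra hT
    have hnot : ∀ x ∈ S, x ≠ s → ¬ A x s := fun x hx hxs h =>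
      hT ⟨x, mem_filter.mpr ⟨hx, hxs, h⟩⟩
    obtain ⟨y, hy, hys, -⟩ := hsy
    obtain ⟨u, hu, -, hfig⟩ := ih (S.erase s).card
      (by rw [← hcard]; exact card_erase_lt_of_mem hs)
      A (S.erase s) y rfl (mem_erase.mpr ⟨hys, hy⟩) (by
        intro v hv _
        obtain ⟨hvs, hvS⟩ := mem_erase.mp hv
        obtain ⟨a, ha, b, hb, hab, hva, hvb⟩ := hdeg v hvS hvs
        refine ⟨a, mem_erase.mpr ⟨?_, ha⟩, b, mem_erase.mpr ⟨?_, hb⟩, hab, hva, hvb⟩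
        · rintro rfl
          exact hnot v hvS hvs hva
        · rintro rfl
          exact hnot v hvS hvs hvb) (by
        obtain ⟨a, ha, has, hay, hya⟩ := hother y hy hys s
        exact ⟨a, mem_erase.mpr ⟨has, ha⟩, hay, hya⟩)
    obtain ⟨hus, huS⟩ := mem_erase.mp hu
    exact hno u huS hus (hfig.mono (erase_subset _ _))
  obtain ⟨c, hc, hcT⟩ := exists_isCycle_of_forall_exists_inNeighbor (A := A) hT (by
    intro x hx
    obtain ⟨hxS, hxs, hxA⟩ := mem_filter.mp hx
    obtain ⟨w, hw, hws, hwx, hwA⟩ := hin x hxS hxs hxA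
    exact ⟨w, mem_filter.mpr ⟨hw, hws, hwA⟩, hwx⟩)
  have hcS : ∀ v ∈ c, v ∈ S := fun v hv => (mem_filter.mp (hcT v hv)).1
  have hcs : ∀ v ∈ c, v ≠ s ∧ A v s := fun v hv => (mem_filter.mp (hcT v hv)).2
  let R := S.filter fun q => Relation.ReflTransGen (fun p q => A p q ∧ p ∉ c ∧ q ∈ S) s q
  have hRc : ∀ v ∈ R, v ∉ c := fun v hv hvc =>
    hno v (hcS v hvc) (hcs v hvc).1 (figureEightOn_of_reach_cycle hs hc hcS
      (fun w hw => (hcs w hw).2) hvc (mem_filter.mp hv).2)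
  have hRcl : ∀ v ∈ R, ∀ a ∈ S, A v a → a ∈ R := fun v hv a ha hva =>
    mem_filter.mpr ⟨ha, (mem_filter.mp hv).2.tail ⟨hva, hRc v hv, ha⟩⟩
  have hsR : s ∈ R := mem_filter.mpr ⟨hs, .refl⟩
  have hRS : R ⊂ S := by
    refine (filter_subset _ _).ssubset_of_ne fun hRS => ?_
    obtain ⟨z, hz⟩ := List.exists_mem_of_ne_nil c hc.1
    exact hRc z (hRS.ge (hcS z hz)) hz
  obtain ⟨u, hu, hus, hfig⟩ := ih R.card (hcard ▸ card_lt_card hRS) A R s rfl hsR (by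
      intro v hv hvs
      obtain ⟨a, ha, b, hb, hab, hva, hvb⟩ := hdeg v (hRS.1 hv) hvs
      exact ⟨a, hRcl v hv a ha hva, b, hRcl v hv b hb hvb, hab, hva, hvb⟩) (by
      obtain ⟨y, hy, hys, hsyA⟩ := hsy
      exact ⟨y, hRcl s hsR y hy hsyA, hys, hsyA⟩)
  exact hno u (hRS.1 hu) hus (hfig.mono hRS.1)

/-- A minimal partial clique with minimum out-degree 2 on at least 3 vertices contains a
figure-of-eight: two directed cycles meeting in exactly one common vertex. -/
theorem stmt19 {V : Type u} [Fintype V] [DecidableEq V] (A : V → V → Prop)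
    (h3 : 3 ≤ Fintype.card V)
    (hdeg : ∀ v : V, 2 ≤ outDeg A v)
    (hmin : ∀ P : Finpartition (univ : Finset V), 2 ≤ P.parts.card →
      ∑ p ∈ P.parts, minOutDegOn A p ≤ 1) :
    ∃ (u : V) (l1 l2 : List V), IsCycle A l1 ∧ IsCycle A l2 ∧
      l1.toFinset ∩ l2.toFinset = {u} := by
  have hdeg' : ∀ v : V, ∃ a b : V, a ≠ b ∧ A v a ∧ A v b := by
    intro v
    obtain ⟨a, ha, b, hb, hab⟩ := one_lt_card.mp (hdeg v)
    exact ⟨a, b, hab, (mem_filter.mp ha).2, (mem_filter.mp hb).2⟩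
  obtain ⟨s⟩ : Nonempty V := Fintype.card_pos_iff.mp (by omega)
  obtain ⟨u, -, -, l₁, l₂, h₁, h₂, -, -, hu⟩ := exists_figureEightOn_ne _ A univ s rfl (mem_univ s)
    (fun v _ _ => by
      obtain ⟨a, b, hab, ha, hb⟩ := hdeg' v
      exact ⟨a, mem_univ a, b, mem_univ b, hab, ha, hb⟩) (by
      obtain ⟨a, b, hab, ha, hb⟩ := hdeg' s
      by_cases has : a = s
      · exact ⟨b, mem_univ b, has ▸ hab.symm, hb⟩
      · exact ⟨a, mem_univ a, has, ha⟩)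
  refine ⟨u, l₁, l₂, h₁, h₂, ?_⟩
  ext v
  simpa using hu v
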